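/- Let w be a vertex of H with deg_H(w) ≤ k-1 and suppose that ē_H(sh_H(w)) < (k-1)·|sh_H(w)|. Then Σ_{s ∈ sh_H(w), deg_H(s) ≤ k-1} (k - deg_H(s)) ≤ 2·((k-1)·|sh_H(w)| - ē_H(sh_H(w))), where the sum ranges over all vertices s of the shadow sh_H(w) with deg_H(s) ≤ k-1. -/

import Mathlib

/-- The number of edges of `H` incident with at least one vertex of `X`. -/
def eBar {V : Type*} [Fintype V] [DecidableEq V] (H : SimpleGraph V) [DecidableRel H.Adj]
    (X : Finset V) : ℕ :=
  (H.edgeFinset.filter (fun e => ∃ v ∈ X, v ∈ e)).card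

/-- A subset `Y ⊆ V(H)` is `w`-closed (with respect to the collection `CH`) if:
(I) `w ∈ Y`; (II) every `D ∈ CH` satisfies `D ⊆ Y` or `D ∩ Y = ∅`; (III) every vertex
outside `Y` adjacent to a vertex of `Y` has degree at least `k` in `H - Y`; (IV) every
`D ∈ CH` adjacent to a vertex of `Y` satisfies `D ⊆ Y`. -/
def WClosed {V : Type*} [Fintype V] [DecidableEq V] (k : ℕ) (H : SimpleGraph V)
    [DecidableRel H.Adj] (CH : Finset (Finset V)) (w : V) (Y : Finset V) : Prop :=
  w ∈ Y ∧
  (∀ D ∈ CH, D ⊆ Y ∨ D ∩ Y = ∅) ∧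
  (∀ v ∉ Y, (∃ y ∈ Y, H.Adj v y) → k ≤ (H.neighborFinset v \ Y).card) ∧
  (∀ D ∈ CH, (∃ d ∈ D, ∃ y ∈ Y, H.Adj d y) → D ⊆ Y)

theorem eBar_insert_le {V : Type*} [Fintype V] [DecidableEq V] (H : SimpleGraph V)
    [DecidableRel H.Adj] (v : V) (Y : Finset V) :
    eBar H (insert v Y) ≤ eBar H Y + (H.neighborFinset v \ Y).card := by
  unfold eBar
  refine le_trans (Finset.card_le_card (t := (H.edgeFinset.filter (fun e => ∃ v ∈ Y, v ∈ e)) ∪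
    (H.neighborFinset v \ Y).image (fun u => s(v, u))) ?_)
    (le_trans (Finset.card_union_le _ _) (Nat.add_le_add_left Finset.card_image_le _))
  intro e he
  rw [Finset.mem_filter] at he
  obtain ⟨he, x, hx, hxe⟩ := he
  rw [Finset.mem_union, Finset.mem_filter]
  by_cases h : ∃ v ∈ Y, v ∈ e
  · exact Or.inl ⟨he, h⟩
  · right
    have hxv : x = v := by
      rcases Finset.mem_insert.1 hx with h1 | h1
      · exact h1
      · exact absurd ⟨x, h1, hxe⟩ h
    subst hxv
    obtain ⟨u, rfl⟩ := Sym2.mem_iff_exists.1 hxe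
    rw [Finset.mem_image]
    refine ⟨u, ?_, rfl⟩
    rw [Finset.mem_sdiff, SimpleGraph.mem_neighborFinset]
    refine ⟨by simpa using he, fun hu => h ⟨u, hu, by simp⟩⟩

theorem eBar_union_lt {V : Type*} [Fintype V] [DecidableEq V] (H : SimpleGraph V)
    [DecidableRel H.Adj] (Y D : Finset V) (d y : V) (hd : d ∈ D) (hy : y ∈ Y)
    (h : H.Adj d y) : eBar H (Y ∪ D) + 1 ≤ eBar H Y + eBar H D := by
  unfold eBar
  rw [← Finset.card_union_add_card_inter]
  refine Nat.add_le_add (Finset.card_le_card ?_) (Finset.card_pos.2 ⟨s(d, y), ?_⟩)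
  · intro e he
    rw [Finset.mem_filter] at he
    obtain ⟨he, x, hx, hxe⟩ := he
    rw [Finset.mem_union, Finset.mem_filter, Finset.mem_filter]
    rcases Finset.mem_union.1 hx with h1 | h1
    · exact Or.inl ⟨he, x, h1, hxe⟩
    · exact Or.inr ⟨he, x, h1, hxe⟩
  · rw [Finset.mem_inter, Finset.mem_filter, Finset.mem_filter]
    have he : s(d, y) ∈ H.edgeFinset := by simpa using h
    exact ⟨⟨he, y, hy, by simp⟩, he, d, hd, by simp⟩

/-- If `ē_H(sh_H(w)) < (k-1)·|sh_H(w)|`, then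
`Σ_{s ∈ sh_H(w), deg_H(s) ≤ k-1} (k - deg_H(s)) ≤ 2((k-1)·|sh_H(w)| - ē_H(sh_H(w)))`. -/
theorem sum_deg_deficiency_shadow_le_two_mul {V : Type*} [Fintype V] [DecidableEq V]
    (k : ℕ) (hk : 2 ≤ k) (H : SimpleGraph V) [DecidableRel H.Adj]
    (CH : Finset (Finset V))
    (hCHne : ∀ D ∈ CH, D.Nonempty)
    (hCHdisj : ∀ D₁ ∈ CH, ∀ D₂ ∈ CH, D₁ ≠ D₂ → Disjoint D₁ D₂)
    (hCHe : ∀ D ∈ CH, eBar H D ≤ (k - 1) * D.card + 1)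
    (hCHdeg : ∀ D ∈ CH, ∀ v ∈ D, k ≤ H.degree v)
    (w : V) (hw : H.degree w ≤ k - 1)
    (Sh : Finset V) (hSh : WClosed k H CH w Sh)
    (hShMin : ∀ Y : Finset V, WClosed k H CH w Y → Sh ⊆ Y)
    (hlt : eBar H Sh < (k - 1) * Sh.card) :
    ∑ s ∈ Sh.filter (fun s => H.degree s ≤ k - 1), ((k : ℤ) - (H.degree s : ℤ))
      ≤ 2 * (((k : ℤ) - 1) * (Sh.card : ℤ) - (eBar H Sh : ℤ)) := by
  obtain ⟨m, rfl⟩ : ∃ m, k = m + 1 := ⟨k - 1, by omega⟩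
  simp only [Nat.add_sub_cancel] at *
  obtain ⟨hwS, hII, hIII, hIV⟩ := id hSh
  have hwD : ∀ D ∈ CH, w ∉ D := fun D hD hwD => by
    have := hCHdeg D hD w hwD
    omega
  let P : Finset V → Prop := fun Y => w ∈ Y ∧ (∀ D ∈ CH, D ⊆ Y ∨ D ∩ Y = ∅) ∧
    ∑ s ∈ Y.filter (fun s => H.degree s ≤ m), (((m + 1 : ℕ) : ℤ) - (H.degree s : ℤ))
      + (eBar H Y : ℤ) ≤ (m : ℤ) * (Y.card : ℤ) + 1
  classical
  have hP0 : P {w} := by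
    refine ⟨by simp, fun D hD => Or.inr ?_, ?_⟩
    · rw [← Finset.disjoint_iff_inter_eq_empty]
      simpa using hwD D hD
    · have h1 := eBar_insert_le H w ∅
      have h0 : eBar H ∅ = 0 := by simp [eBar]
      simp only [h0, Finset.sdiff_empty, SimpleGraph.card_neighborFinset_eq_degree,
        insert_empty_eq] at h1
      rw [Finset.filter_singleton, if_pos hw]
      simp only [Finset.sum_singleton, Finset.card_singleton]
      push_cast
      omega
  obtain ⟨Y, hY, hYmax⟩ := Finset.exists_max_image (Sh.powerset.filter P) Finset.card
    ⟨{w}, by simp [hP0, hwS]⟩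
  rw [Finset.mem_filter, Finset.mem_powerset] at hY
  obtain ⟨hYS, hwY, hYII, hYsum⟩ := hY
  have hno : ∀ Z, Z ⊆ Sh → P Z → Y.card < Z.card → False := fun Z h1 h2 h3 => by
    have := hYmax Z (by rw [Finset.mem_filter, Finset.mem_powerset]; exact ⟨h1, h2⟩)
    omega
  have hYIV : ∀ D ∈ CH, (∃ d ∈ D, ∃ y ∈ Y, H.Adj d y) → D ⊆ Y := by
    rintro D hD ⟨d, hd, y, hy, hdy⟩
    by_contra hDY
    have hdis : D ∩ Y = ∅ := (hYII D hD).resolve_left hDY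
    have hdis' : Disjoint Y D := by
      rw [Finset.disjoint_iff_inter_eq_empty, Finset.inter_comm]; exact hdis
    have hcard := Finset.card_union_of_disjoint hdis'
    have hDpos := Finset.card_pos.2 (hCHne D hD)
    refine hno (Y ∪ D) (Finset.union_subset hYS (hIV D hD ⟨d, hd, y, hYS hy, hdy⟩)) ?_ (by omega)
    refine ⟨Finset.mem_union_left _ hwY, ?_, ?_⟩
    · intro D' hD'
      by_cases hDD : D' = D
      · subst hDD; exact Or.inl Finset.subset_union_right
      · rcases hYII D' hD' with h | h
        · exact Or.inl (h.trans Finset.subset_union_left)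
        · right
          rw [Finset.inter_union_distrib_left, h, Finset.empty_union]
          exact Finset.disjoint_iff_inter_eq_empty.1 (hCHdisj D' hD' D hD hDD)
    · have hf : D.filter (fun s => H.degree s ≤ m) = ∅ := by
        rw [Finset.filter_eq_empty_iff]
        intro x hx
        have := hCHdeg D hD x hx
        omega
      rw [Finset.filter_union, hf, Finset.union_empty, hcard]
      have h1 := eBar_union_lt H Y D d y hd hy hdy
      have h2 := hCHe D hD
      zify at h1 h2
      push_cast at *
      linarith
  have hYIII : ∀ v ∉ Y, (∃ y ∈ Y, H.Adj v y) → m + 1 ≤ (H.neighborFinset v \ Y).card := by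
    rintro v hv ⟨y, hy, hvy⟩
    by_contra hlow
    have hvS : v ∈ Sh := by
      by_contra hvS
      have h1 := hIII v hvS ⟨y, hYS hy, hvy⟩
      have h2 := Finset.card_le_card (Finset.sdiff_subset_sdiff (le_refl (H.neighborFinset v)) hYS)
      omega
    have hvD : ∀ D ∈ CH, v ∉ D := fun D hD hvD => hv (hYIV D hD ⟨v, hvD, y, hy, hvy⟩ hvD)
    have hcard := Finset.card_insert_of_notMem hv
    refine hno (insert v Y) (Finset.insert_subset hvS hYS) ?_ (by omega)
    refine ⟨Finset.mem_insert_of_mem hwY, ?_, ?_⟩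
    · intro D hD
      rcases hYII D hD with h | h
      · exact Or.inl (h.trans (Finset.subset_insert _ _))
      · right
        rw [Finset.inter_insert_of_notMem (hvD D hD), h]
    · have h1 := eBar_insert_le H v Y
      have hdeg : (H.neighborFinset v \ Y).card + 1 ≤ H.degree v := by
        rw [← SimpleGraph.card_neighborFinset_eq_degree]
        apply Finset.card_lt_card
        rw [Finset.ssubset_iff_of_subset Finset.sdiff_subset]
        exact ⟨y, by simpa using hvy, by simp [hy]⟩
      rw [Finset.filter_insert, hcard]
      split_ifs with hdv
      · rw [Finset.sum_insert (by simp [hv])]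
        zify at h1 hdeg
        push_cast at *
        linarith
      · zify at h1 hlow
        push_cast at *
        linarith
  have hEq : Y = Sh := Finset.Subset.antisymm hYS (hShMin Y ⟨hwY, hYII, hYIII, hYIV⟩)
  subst hEq
  zify at hlt
  push_cast at *
  linarith
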